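/- The supremum, over all convex pentagons P in the plane, of the infimum over all convex quadrilaterals Q containing P of the ratio |Q|/|P|, equals 3/√5. (In the paper's notation, r(4,5) = 3/√5.) -/

import Mathlib

open MeasureTheory

/-- A convex `n`-gon in the plane: the convex hull of a finite set of at most `n` points,
having nonempty interior. -/
def IsConvexPolygon (n : ℕ) (Q : Set (ℝ × ℝ)) : Prop :=
  ∃ S : Finset (ℝ × ℝ), S.card ≤ n ∧ Q = convexHull ℝ (S : Set (ℝ × ℝ)) ∧
    (interior Q).Nonempty

/-- Twice the signed area of the triangle `a b c`. -/
def orient (a b c : ℝ × ℝ) : ℝ :=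
  (b.1 - a.1) * (c.2 - a.2) - (b.2 - a.2) * (c.1 - a.1)

theorem convex_setOf_orient_nonneg (a b : ℝ × ℝ) : Convex ℝ {x | 0 ≤ orient a b x} := by
  intro x hx y hy s t hs ht hst
  simp only [Set.mem_ofPred_eq, orient] at *
  have h : (b.1 - a.1) * ((s • x + t • y).2 - a.2) - (b.2 - a.2) * ((s • x + t • y).1 - a.1) =
      s * ((b.1 - a.1) * (x.2 - a.2) - (b.2 - a.2) * (x.1 - a.1)) +
      t * ((b.1 - a.1) * (y.2 - a.2) - (b.2 - a.2) * (y.1 - a.1)) := by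
    simp only [Prod.fst_add, Prod.snd_add, Prod.smul_fst, Prod.smul_snd, smul_eq_mul]
    obtain rfl : s = 1 - t := by linarith
    ring
  rw [h]
  positivity

theorem orient_nonneg_of_mem_convexHull {a b x : ℝ × ℝ} {s : Set (ℝ × ℝ)}
    (h : ∀ p ∈ s, 0 ≤ orient a b p) (hx : x ∈ convexHull ℝ s) : 0 ≤ orient a b x :=
  convexHull_min (t := {x | 0 ≤ orient a b x}) h (convex_setOf_orient_nonneg a b) hx

theorem orient_rotate (a b c : ℝ × ℝ) : orient b c a = orient a b c := by
  simp only [orient]; ring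

theorem orient_swap (a b c : ℝ × ℝ) : orient b a c = -orient a b c := by
  simp only [orient]; ring

theorem orient_self_left (a b : ℝ × ℝ) : orient a b a = 0 := by simp only [orient]; ring

theorem orient_self_right (a b : ℝ × ℝ) : orient a b b = 0 := by simp only [orient]; ring

theorem volume_setOf_orient_eq_zero {a b : ℝ × ℝ} (hab : a ≠ b) :
    volume {x | orient a b x = 0} = 0 := by
  have h0 : (b.1 - a.1, b.2 - a.2) ≠ (0 : ℝ × ℝ) := by
    intro h
    simp only [Prod.mk_eq_zero] at h
    exact hab (Prod.ext (by linarith) (by linarith))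
  let L : (ℝ × ℝ) →ₗ[ℝ] ℝ := (b.1 - a.1) • LinearMap.snd ℝ ℝ ℝ - (b.2 - a.2) • LinearMap.fst ℝ ℝ ℝ
  have hL : ∀ x, L x = (b.1 - a.1) * x.2 - (b.2 - a.2) * x.1 := fun x => by simp [L]
  have hker : L.ker ≠ ⊤ := by
    intro h
    have h1 : L (-(b.2 - a.2), b.1 - a.1) = 0 := by
      have : (-(b.2 - a.2), b.1 - a.1) ∈ L.ker := h ▸ Submodule.mem_top
      exact this
    rw [hL] at h1
    apply h0
    have h2 : (b.1 - a.1) ^ 2 + (b.2 - a.2) ^ 2 = 0 := by simp only at h1; nlinarith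
    have h3 : b.1 - a.1 = 0 := by nlinarith [sq_nonneg (b.1 - a.1), sq_nonneg (b.2 - a.2)]
    have h4 : b.2 - a.2 = 0 := by nlinarith [sq_nonneg (b.1 - a.1), sq_nonneg (b.2 - a.2)]
    simp [h3, h4]
  have h1 := Measure.addHaar_submodule (volume : Measure (ℝ × ℝ)) L.ker hker
  have h2 : {x | orient a b x = 0} = (fun x => x + -a) ⁻¹' (L.ker : Set (ℝ × ℝ)) := by
    ext x
    simp only [Set.mem_ofPred_eq, Set.mem_preimage, SetLike.mem_coe, LinearMap.mem_ker, hL, orient,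
      Prod.fst_add, Prod.snd_add, Prod.fst_neg, Prod.snd_neg, sub_eq_add_neg]
  rw [h2, measure_preimage_add_right, h1]

theorem volume_unit_triangle :
    volume {p : ℝ × ℝ | 0 ≤ p.1 ∧ 0 ≤ p.2 ∧ p.1 + p.2 ≤ 1} = ENNReal.ofReal (1 / 2) := by
  have hm : MeasurableSet {p : ℝ × ℝ | 0 ≤ p.1 ∧ 0 ≤ p.2 ∧ p.1 + p.2 ≤ 1} :=
    ((isClosed_le continuous_const continuous_fst).inter
      ((isClosed_le continuous_const continuous_snd).inter
        (isClosed_le (continuous_fst.add continuous_snd) continuous_const))).measurableSet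
  rw [Measure.volume_eq_prod, Measure.prod_apply hm]
  have h : ∀ x : ℝ, volume (Prod.mk x ⁻¹' {p : ℝ × ℝ | 0 ≤ p.1 ∧ 0 ≤ p.2 ∧ p.1 + p.2 ≤ 1}) =
      (Set.Icc (0 : ℝ) 1).indicator (fun x => ENNReal.ofReal (1 - x)) x := by
    intro x
    by_cases hx : x ∈ Set.Icc (0 : ℝ) 1
    · rw [Set.indicator_of_mem hx]
      have : Prod.mk x ⁻¹' {p : ℝ × ℝ | 0 ≤ p.1 ∧ 0 ≤ p.2 ∧ p.1 + p.2 ≤ 1} =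
          Set.Icc 0 (1 - x) := by
        ext y
        simp only [Set.mem_preimage, Set.mem_ofPred_eq, Set.mem_Icc]
        constructor
        · rintro ⟨_, h1, h2⟩; exact ⟨h1, by linarith⟩
        · rintro ⟨h1, h2⟩; exact ⟨hx.1, h1, by linarith⟩
      rw [this, Real.volume_Icc, sub_zero]
    · rw [Set.indicator_of_notMem hx]
      have : Prod.mk x ⁻¹' {p : ℝ × ℝ | 0 ≤ p.1 ∧ 0 ≤ p.2 ∧ p.1 + p.2 ≤ 1} = ∅ := by
        ext y
        simp only [Set.mem_preimage, Set.mem_ofPred_eq, Set.mem_empty_iff_false, iff_false]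
        rintro ⟨h0, h1, h2⟩
        exact hx ⟨h0, by linarith⟩
      rw [this, measure_empty]
  simp_rw [h]
  rw [lintegral_indicator measurableSet_Icc, ← ofReal_integral_eq_lintegral_ofReal]
  · congr 1
    rw [integral_Icc_eq_integral_Ioc, ← intervalIntegral.integral_of_le zero_le_one]
    rw [intervalIntegral.integral_sub (by simp) (by simp)]
    simp; norm_num
  · exact (continuous_const.sub continuous_id).continuousOn.integrableOn_compact isCompact_Icc
  · filter_upwards [ae_restrict_mem measurableSet_Icc] with x hx
    simpa using hx.2

theorem mem_convexHull_triple_iff {a b c : ℝ × ℝ} (h : 0 < orient a b c) (x : ℝ × ℝ) :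
    x ∈ convexHull ℝ {a, b, c} ↔ 0 ≤ orient a b x ∧ 0 ≤ orient b c x ∧ 0 ≤ orient c a x := by
  constructor
  · intro hx
    refine ⟨orient_nonneg_of_mem_convexHull ?_ hx, orient_nonneg_of_mem_convexHull ?_ hx,
      orient_nonneg_of_mem_convexHull ?_ hx⟩ <;>
    · simp only [Set.mem_insert_iff, Set.mem_singleton_iff]
      rintro p (rfl | rfl | rfl) <;> simp only [orient] at * <;> linarith
  · rintro ⟨h1, h2, h3⟩
    have hx : x = (orient b c x / orient a b c) • a + (orient c a x / orient a b c) • b +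
        (orient a b x / orient a b c) • c := by
      have h' := h.ne'
      refine Prod.ext ?_ ?_ <;>
      · simp only [Prod.fst_add, Prod.snd_add, Prod.smul_fst, Prod.smul_snd, smul_eq_mul]
        field_simp
        simp only [orient]
        ring
    rw [hx]
    have hc := convex_convexHull ℝ ({a, b, c} : Set (ℝ × ℝ))
    have hsum : orient b c x / orient a b c + orient c a x / orient a b c +
        orient a b x / orient a b c = 1 := by
      have h' := h.ne'
      field_simp
      simp only [orient]
      ring
    have := hc.sum_mem (t := Finset.univ)
      (w := ![orient b c x / orient a b c, orient c a x / orient a b c, orient a b x / orient a b c])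
      (z := ![a, b, c]) (by intro i _; fin_cases i <;> simp <;> positivity)
      (by simpa [Fin.sum_univ_three] using hsum)
      (by intro i _; apply subset_convexHull; fin_cases i <;> simp)
    simpa [Fin.sum_univ_three] using this

theorem volume_convexHull_triple {a b c : ℝ × ℝ} (h : 0 < orient a b c) :
    volume (convexHull ℝ {a, b, c}) = ENNReal.ofReal (orient a b c / 2) := by
  let M : Matrix (Fin 2) (Fin 2) ℝ := !![b.1 - a.1, c.1 - a.1; b.2 - a.2, c.2 - a.2]
  let L := Matrix.toLin (Module.Basis.finTwoProd ℝ) (Module.Basis.finTwoProd ℝ) M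
  have hL : ∀ p : ℝ × ℝ, L p = ((b.1 - a.1) * p.1 + (c.1 - a.1) * p.2,
      (b.2 - a.2) * p.1 + (c.2 - a.2) * p.2) := fun p =>
    Matrix.toLin_finTwoProd_apply _ _ _ _ _
  have hdet : LinearMap.det L = orient a b c := by
    rw [LinearMap.det_toLin, Matrix.det_fin_two_of, orient]; ring
  have himg : convexHull ℝ {a, b, c} =
      (fun x => a + x) '' (L '' {p : ℝ × ℝ | 0 ≤ p.1 ∧ 0 ≤ p.2 ∧ p.1 + p.2 ≤ 1}) := by
    ext x
    rw [mem_convexHull_triple_iff h, Set.image_image]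
    constructor
    · rintro ⟨h1, h2, h3⟩
      refine ⟨(orient c a x / orient a b c, orient a b x / orient a b c),
        ⟨by positivity, by positivity, ?_⟩, ?_⟩
      · simp only
        rw [← add_div, div_le_one h]
        simp only [orient] at *
        linarith
      · have h' := h.ne'
        simp only [hL]
        refine Prod.ext ?_ ?_ <;>
        · simp only [Prod.fst_add, Prod.snd_add]
          field_simp
          simp only [orient]
          ring
    · rintro ⟨⟨u, v⟩, ⟨hu, hv, huv⟩, rfl⟩
      simp only at hu hv huv
      simp only [hL]
      have e1 : orient a b (a + ((b.1 - a.1) * u + (c.1 - a.1) * v,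
        (b.2 - a.2) * u + (c.2 - a.2) * v)) = v * orient a b c := by simp [orient]; ring
      have e2 : orient b c (a + ((b.1 - a.1) * u + (c.1 - a.1) * v,
        (b.2 - a.2) * u + (c.2 - a.2) * v)) = (1 - u - v) * orient a b c := by simp [orient]; ring
      have e3 : orient c a (a + ((b.1 - a.1) * u + (c.1 - a.1) * v,
        (b.2 - a.2) * u + (c.2 - a.2) * v)) = u * orient a b c := by simp [orient]; ring
      rw [e1, e2, e3]
      have : 0 ≤ 1 - u - v := by linarith
      exact ⟨by positivity, by positivity, by positivity⟩
  rw [himg, Set.image_add_left, measure_preimage_add, Measure.addHaar_image_linearMap, hdet,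
    volume_unit_triangle, abs_of_pos h, ← ENNReal.ofReal_mul h.le]
  congr 1
  ring

theorem volume_union_of_separated {a b : ℝ × ℝ} (hab : a ≠ b) {s t : Set (ℝ × ℝ)}
    (ht : MeasurableSet t) (hs' : ∀ x ∈ s, 0 ≤ orient a b x) (ht' : ∀ x ∈ t, orient a b x ≤ 0) :
    volume (s ∪ t) = volume s + volume t := by
  refine measure_union₀ ht.nullMeasurableSet (measure_mono_null ?_ (volume_setOf_orient_eq_zero hab))
  rintro x ⟨h1, h2⟩
  exact le_antisymm (ht' x h2) (hs' x h1)

theorem measurableSet_convexHull_of_finite {s : Set (ℝ × ℝ)} (hs : s.Finite) :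
    MeasurableSet (convexHull ℝ s) := (hs.isClosed_convexHull ℝ).measurableSet

theorem ne_of_orient_pos {a b c : ℝ × ℝ} (h : 0 < orient a b c) : a ≠ b := by
  rintro rfl; simp [orient] at h

theorem convexHull_quad_eq {a b c d : ℝ × ℝ} (habc : 0 < orient a b c) (habd : 0 < orient a b d)
    (hacd : 0 < orient a c d) (hbcd : 0 < orient b c d) :
    convexHull ℝ {a, b, c, d} = convexHull ℝ {a, b, c} ∪ convexHull ℝ {a, c, d} := by
  apply Set.Subset.antisymm
  · intro x hx
    have h1 : 0 ≤ orient a b x := orient_nonneg_of_mem_convexHull (by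
      simp only [Set.mem_insert_iff, Set.mem_singleton_iff]
      rintro p (rfl | rfl | rfl | rfl) <;> simp only [orient] at * <;> linarith) hx
    have h2 : 0 ≤ orient b c x := orient_nonneg_of_mem_convexHull (by
      simp only [Set.mem_insert_iff, Set.mem_singleton_iff]
      rintro p (rfl | rfl | rfl | rfl) <;> simp only [orient] at * <;> linarith) hx
    have h3 : 0 ≤ orient c d x := orient_nonneg_of_mem_convexHull (by
      simp only [Set.mem_insert_iff, Set.mem_singleton_iff]
      rintro p (rfl | rfl | rfl | rfl) <;> simp only [orient] at * <;> linarith) hx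
    have h4 : 0 ≤ orient d a x := orient_nonneg_of_mem_convexHull (by
      simp only [Set.mem_insert_iff, Set.mem_singleton_iff]
      rintro p (rfl | rfl | rfl | rfl) <;> simp only [orient] at * <;> linarith) hx
    rcases le_total 0 (orient c a x) with h | h
    · exact Or.inl ((mem_convexHull_triple_iff habc x).2 ⟨h1, h2, h⟩)
    · refine Or.inr ((mem_convexHull_triple_iff hacd x).2 ⟨?_, h3, h4⟩)
      rw [orient_swap]; linarith
  · apply Set.union_subset <;> apply convexHull_mono <;> intro x <;> simp <;> tauto

theorem volume_convexHull_quad {a b c d : ℝ × ℝ} (habc : 0 < orient a b c)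
    (habd : 0 < orient a b d) (hacd : 0 < orient a c d) (hbcd : 0 < orient b c d) :
    volume (convexHull ℝ {a, b, c, d}) =
      ENNReal.ofReal ((orient a b c + orient a c d) / 2) := by
  rw [convexHull_quad_eq habc habd hacd hbcd, Set.union_comm,
    volume_union_of_separated (ne_of_orient_pos hacd)
      (measurableSet_convexHull_of_finite (Set.toFinite _))
      (fun x hx => ((mem_convexHull_triple_iff hacd x).1 hx).1)
      (fun x hx => by
        have := ((mem_convexHull_triple_iff habc x).1 hx).2.2
        rw [orient_swap] at this
        linarith),
    volume_convexHull_triple habc, volume_convexHull_triple hacd,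
    ← ENNReal.ofReal_add (by positivity) (by positivity)]
  congr 1
  ring

/-- All triples of the sequence `V`, taken in increasing order, are positively oriented. -/
def IsPosOriented {n : ℕ} (V : Fin n → ℝ × ℝ) : Prop :=
  ∀ i j k, i < j → j < k → 0 < orient (V i) (V j) (V k)

theorem volume_convexHull_pentagon {a b c d e : ℝ × ℝ} (habc : 0 < orient a b c)
    (habd : 0 < orient a b d) (habe : 0 < orient a b e) (hacd : 0 < orient a c d)
    (hace : 0 < orient a c e) (hade : 0 < orient a d e) (hbcd : 0 < orient b c d)
    (hbce : 0 < orient b c e) (hbde : 0 < orient b d e) (hcde : 0 < orient c d e) :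
    volume (convexHull ℝ {a, b, c, d, e}) =
      ENNReal.ofReal ((orient a b c + orient a c d + orient a d e) / 2) := by
  have h : convexHull ℝ {a, b, c, d, e} = convexHull ℝ {a, d, e} ∪ convexHull ℝ {a, b, c, d} := by
    apply Set.Subset.antisymm
    · intro x hx
      have h1 : 0 ≤ orient a b x := orient_nonneg_of_mem_convexHull (by
        simp only [Set.mem_insert_iff, Set.mem_singleton_iff]
        rintro p (rfl | rfl | rfl | rfl | rfl) <;> simp only [orient] at * <;> linarith) hx
      have h2 : 0 ≤ orient b c x := orient_nonneg_of_mem_convexHull (by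
        simp only [Set.mem_insert_iff, Set.mem_singleton_iff]
        rintro p (rfl | rfl | rfl | rfl | rfl) <;> simp only [orient] at * <;> linarith) hx
      have h3 : 0 ≤ orient c d x := orient_nonneg_of_mem_convexHull (by
        simp only [Set.mem_insert_iff, Set.mem_singleton_iff]
        rintro p (rfl | rfl | rfl | rfl | rfl) <;> simp only [orient] at * <;> linarith) hx
      have h4 : 0 ≤ orient d e x := orient_nonneg_of_mem_convexHull (by
        simp only [Set.mem_insert_iff, Set.mem_singleton_iff]
        rintro p (rfl | rfl | rfl | rfl | rfl) <;> simp only [orient] at * <;> linarith) hx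
      have h5 : 0 ≤ orient e a x := orient_nonneg_of_mem_convexHull (by
        simp only [Set.mem_insert_iff, Set.mem_singleton_iff]
        rintro p (rfl | rfl | rfl | rfl | rfl) <;> simp only [orient] at * <;> linarith) hx
      rcases le_total 0 (orient a d x) with h | h
      · exact Or.inl ((mem_convexHull_triple_iff hade x).2 ⟨h, h4, h5⟩)
      · refine Or.inr ?_
        rw [convexHull_quad_eq habc habd hacd hbcd]
        rcases le_total 0 (orient a c x) with h' | h'
        · refine Or.inr ((mem_convexHull_triple_iff hacd x).2 ⟨h', h3, ?_⟩)
          rw [orient_swap]; linarith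
        · refine Or.inl ((mem_convexHull_triple_iff habc x).2 ⟨h1, h2, ?_⟩)
          rw [orient_swap]; linarith
    · apply Set.union_subset <;> apply convexHull_mono <;> intro x <;> simp <;> tauto
  rw [h, volume_union_of_separated (ne_of_orient_pos hade)
      (measurableSet_convexHull_of_finite (Set.toFinite _))
      (fun x hx => ((mem_convexHull_triple_iff hade x).1 hx).1)
      (fun x hx => by
        have : 0 ≤ orient d a x := orient_nonneg_of_mem_convexHull (by
          simp only [Set.mem_insert_iff, Set.mem_singleton_iff]
          rintro p (rfl | rfl | rfl | rfl) <;> simp only [orient] at * <;> linarith) hx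
        rw [orient_swap] at this
        linarith),
    volume_convexHull_quad habc habd hacd hbcd, volume_convexHull_triple hade,
    ← ENNReal.ofReal_add (by positivity) (by positivity)]
  congr 1
  ring

/-- A finite set has a convexly independent subset with the same convex hull. -/
theorem exists_subset_convexHull_eq (S : Finset (ℝ × ℝ)) :
    ∃ T ⊆ S, convexHull ℝ (T : Set (ℝ × ℝ)) = convexHull ℝ (S : Set (ℝ × ℝ)) ∧
      ∀ p ∈ T, p ∉ convexHull ℝ ((T : Set (ℝ × ℝ)) \ {p}) := by
  induction S using Finset.strongInduction with
  | H S ih =>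
    by_cases h : ∀ p ∈ S, p ∉ convexHull ℝ ((S : Set (ℝ × ℝ)) \ {p})
    · exact ⟨S, subset_rfl, rfl, h⟩
    · push Not at h
      obtain ⟨p, hp, hpS⟩ := h
      obtain ⟨T, hT, hTS, hind⟩ := ih _ (Finset.erase_ssubset hp)
      refine ⟨T, hT.trans (Finset.erase_subset _ _), ?_, hind⟩
      rw [hTS, Finset.coe_erase]
      refine Set.Subset.antisymm (convexHull_mono Set.sdiff_subset)
        (convexHull_min (fun x hx => ?_) (convex_convexHull ℝ _))
      by_cases hxp : x = p
      · exact hxp ▸ hpS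
      · exact subset_convexHull ℝ _ ⟨hx, hxp⟩

theorem mem_segment_of_smul {a p q : ℝ × ℝ} {s t : ℝ} (hs : 0 < s) (hst : s ≤ t)
    (h1 : t * (p.1 - a.1) = s * (q.1 - a.1)) (h2 : t * (p.2 - a.2) = s * (q.2 - a.2)) :
    p ∈ segment ℝ a q := by
  have ht : 0 < t := hs.trans_le hst
  refine ⟨1 - s / t, s / t, ?_, by positivity, by ring, ?_⟩
  · rw [sub_nonneg, div_le_one ht]; exact hst
  · refine Prod.ext ?_ ?_ <;>
    · simp only [Prod.fst_add, Prod.snd_add, Prod.smul_fst, Prod.smul_snd, smul_eq_mul]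
      field_simp
      linarith

/-- A convexly independent finite set can be listed in counterclockwise order. -/
theorem exists_isPosOriented {n : ℕ} {T : Finset (ℝ × ℝ)} (hcard : T.card = n + 1)
    (hT : ∀ p ∈ T, p ∉ convexHull ℝ ((T : Set (ℝ × ℝ)) \ {p})) :
    ∃ V : Fin (n + 1) → ℝ × ℝ, Set.range V = T ∧ IsPosOriented V := by
  obtain ⟨a, ha⟩ : T.Nonempty := by rw [← Finset.card_pos]; omega
  have hfin : ((T : Set (ℝ × ℝ)) \ {a}).Finite := T.finite_toSet.subset Set.sdiff_subset
  obtain ⟨F, u, hFa, hFu⟩ := geometric_hahn_banach_point_closed (convex_convexHull ℝ _)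
    (hfin.isClosed_convexHull ℝ) (hT a ha)
  set α := F (1, 0) with hα
  set β := F (0, 1) with hβ
  have hF : ∀ p : ℝ × ℝ, F p = α * p.1 + β * p.2 := by
    intro p
    have : p = p.1 • ((1 : ℝ), (0 : ℝ)) + p.2 • ((0 : ℝ), (1 : ℝ)) := by
      refine Prod.ext ?_ ?_ <;> simp
    conv_lhs => rw [this]
    rw [map_add, map_smul, map_smul, smul_eq_mul, smul_eq_mul, ← hα, ← hβ]
    ring
  let f : ℝ × ℝ → ℝ := fun p => α * (p.1 - a.1) + β * (p.2 - a.2)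
  let g : ℝ × ℝ → ℝ := fun p => α * (p.2 - a.2) - β * (p.1 - a.1)
  have hf : ∀ p ∈ T.erase a, 0 < f p := by
    intro p hp
    rw [Finset.mem_erase] at hp
    have h1 := hFu p (subset_convexHull ℝ _ ⟨hp.2, hp.1⟩)
    have h2 := hF p
    have h3 := hF a
    simp only [f]
    linarith
  have hfg : ∀ p q, f p * g q - f q * g p = (α ^ 2 + β ^ 2) * orient a p q := by
    intro p q; simp only [f, g, orient]; ring
  have hab : ∀ p ∈ T.erase a, 0 < α ^ 2 + β ^ 2 := by
    intro p hp
    have h1 := hf p hp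
    by_contra! h
    have hα0 : α = 0 := by nlinarith [sq_nonneg α, sq_nonneg β]
    have hβ0 : β = 0 := by nlinarith [sq_nonneg α, sq_nonneg β]
    simp [f, hα0, hβ0] at h1
  have hseg : ∀ p ∈ T.erase a, ∀ q ∈ T.erase a, orient a p q = 0 → f p ≤ f q → p = q := by
    intro p hp q hq h0 hle
    by_contra hne
    rw [Finset.mem_erase] at hp hq
    refine hT p hp.2 (segment_subset_convexHull (s := (T : Set (ℝ × ℝ)) \ {p}) (x := a) (y := q)
      ⟨ha, fun h => hp.1 h.symm⟩ ⟨hq.2, fun h => hne h.symm⟩ ?_)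
    have hp' := hf p (Finset.mem_erase.2 hp)
    refine mem_segment_of_smul hp' hle ?_ ?_
    · simp only [f, orient] at *; linear_combination β * h0
    · simp only [f, orient] at *; linear_combination -α * h0
  have hinj : ∀ p ∈ T.erase a, ∀ q ∈ T.erase a, g p / f p = g q / f q → p = q := by
    intro p hp q hq h
    have hp' := hf p hp
    have hq' := hf q hq
    rw [div_eq_div_iff hp'.ne' hq'.ne'] at h
    have h0 : orient a p q = 0 := by
      have := hfg p q
      have h3 : (α ^ 2 + β ^ 2) * orient a p q = 0 := by linarith
      exact (mul_eq_zero.1 h3).resolve_left (hab p hp).ne'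
    rcases le_total (f p) (f q) with hle | hle
    · exact hseg p hp q hq h0 hle
    · refine (hseg q hq p hp ?_ hle).symm
      simp only [orient] at *; linarith
  have hcard' : (T.erase a).card = n := by rw [Finset.card_erase_of_mem ha]; omega
  let e : Fin n ≃ T.erase a := ((T.erase a).equivFinOfCardEq hcard').symm
  let σ := Tuple.sort (fun i => g (e i) / f (e i))
  let W : Fin n → ℝ × ℝ := fun i => e (σ i)
  have hWmem : ∀ i, W i ∈ T.erase a := fun i => (e (σ i)).2
  have hWmono : ∀ i j, i < j → g (W i) / f (W i) < g (W j) / f (W j) := by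
    intro i j hij
    refine lt_of_le_of_ne (Tuple.monotone_sort (fun i => g (e i) / f (e i)) hij.le) fun h => ?_
    have := hinj _ (hWmem i) _ (hWmem j) h
    exact hij.ne (σ.injective (e.injective (Subtype.ext this)))
  have hWor : ∀ i j, i < j → 0 < orient a (W i) (W j) := by
    intro i j hij
    have h := hWmono i j hij
    rw [div_lt_div_iff₀ (hf _ (hWmem i)) (hf _ (hWmem j))] at h
    have h2 := hfg (W i) (W j)
    have h3 : 0 < (α ^ 2 + β ^ 2) * orient a (W i) (W j) := by linarith
    exact pos_of_mul_pos_right h3 (hab _ (hWmem i)).le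
  refine ⟨Fin.cons a W, ?_, ?_⟩
  · rw [Fin.range_cons]
    have : Set.range W = (T.erase a : Finset (ℝ × ℝ)) := by
      ext x
      constructor
      · rintro ⟨i, rfl⟩; exact hWmem i
      · intro hx
        refine ⟨σ.symm (e.symm ⟨x, hx⟩), ?_⟩
        simp [W]
    rw [this, Finset.coe_erase, Set.insert_sdiff_singleton, Set.insert_eq_of_mem]
    exact ha
  · intro i j k hij hjk
    obtain ⟨j, rfl⟩ := Fin.exists_succ_eq.2 (Fin.pos_iff_ne_zero.1 (lt_of_le_of_lt (Fin.zero_le i) hij))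
    obtain ⟨k, rfl⟩ := Fin.exists_succ_eq.2 (Fin.pos_iff_ne_zero.1 (lt_of_le_of_lt (Fin.zero_le _) hjk))
    have hjk' : j < k := by simpa using hjk
    induction i using Fin.cases with
    | zero => simpa using hWor j k hjk'
    | succ i =>
      have hij' : i < j := by simpa using hij
      simp only [Fin.cons_succ]
      by_contra! hneg
      have h1 := hWor i j hij'
      have h2 := hWor j k hjk'
      have h3 := hWor i k (hij'.trans hjk')
      have hmem := Finset.mem_erase.1 (hWmem j)
      have hWinj : ∀ i j, i < j → W i ≠ W j := fun i j hij h => by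
        have := hWmono i j hij; rw [h] at this; exact lt_irrefl _ this
      refine hT (W j) hmem.2 (convexHull_mono (s := {a, W i, W k}) ?_
        ((mem_convexHull_triple_iff h3 _).2 ⟨h1.le, ?_, ?_⟩))
      · rintro x (rfl | rfl | rfl)
        · exact ⟨ha, fun h => hmem.1 h.symm⟩
        · exact ⟨(Finset.mem_erase.1 (hWmem i)).2, hWinj _ _ hij'⟩
        · exact ⟨(Finset.mem_erase.1 (hWmem k)).2, (hWinj _ _ hjk').symm⟩
      · simp only [orient] at *; linarith
      · simp only [orient] at *; linarith

/-- Gauss's pentagon formula, with `S` the area and `a`, …, `e` the areas of the five ears. -/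
theorem gauss_pentagon (a b c d e : ℝ × ℝ) :
    let S := orient a b c + orient a c d + orient a d e
    S ^ 2 - S * (orient e a b + orient a b c + orient b c d + orient c d e + orient d e a) +
      (orient e a b * orient a b c + orient a b c * orient b c d + orient b c d * orient c d e +
        orient c d e * orient d e a + orient d e a * orient e a b) = 0 := by
  simp only [orient]
  ring

/-- The smallest ear has at most the proportion it has in the regular pentagon. -/
theorem min_ear_le {S a b c d e : ℝ} (hab : a ≤ b) (hac : a ≤ c) (had : a ≤ d)
    (hae : a ≤ e) (hac' : a + c ≤ S) (hbd : b + d ≤ S) (hce : c + e ≤ S) (hda : d + a ≤ S)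
    (heb : e + b ≤ S)
    (h : S ^ 2 - S * (a + b + c + d + e) + (a * b + b * c + c * d + d * e + e * a) = 0) :
    a ≤ (5 - √5) / 10 * S := by
  have h5 : √5 ^ 2 = 5 := Real.sq_sqrt (by norm_num)
  have h5' : 2 < √5 := by
    rw [Real.lt_sqrt (by norm_num)]; norm_num
  obtain ⟨p, rfl⟩ : ∃ p, b = a + p := ⟨b - a, by ring⟩
  obtain ⟨q, rfl⟩ : ∃ q, c = a + q := ⟨c - a, by ring⟩
  obtain ⟨r, rfl⟩ : ∃ r, d = a + r := ⟨d - a, by ring⟩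
  obtain ⟨s, rfl⟩ : ∃ s, e = a + s := ⟨e - a, by ring⟩
  have hp : 0 ≤ p := by linarith
  have hq : 0 ≤ q := by linarith
  have hr : 0 ≤ r := by linarith
  have hs : 0 ≤ s := by linarith
  have key : 0 ≤ S ^ 2 - 5 * a * S + 5 * a ^ 2 := by
    have h1 : 0 ≤ p * (S - 2 * a - r - s + s) := mul_nonneg hp (by linarith)
    have h2 : 0 ≤ q * (S - 2 * a - s) := mul_nonneg hq (by linarith)
    have h3 : 0 ≤ r * (S - 2 * a - p) := mul_nonneg hr (by linarith)
    have h4 : 0 ≤ s * (S - 2 * a - q) := mul_nonneg hs (by linarith)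
    have h5 : 0 ≤ p * (S - 2 * a - s) := mul_nonneg hp (by linarith)
    nlinarith [mul_nonneg hp hq, mul_nonneg hq hr, mul_nonneg hr hs, mul_nonneg hp hs,
      mul_nonneg hp hr, mul_nonneg hq hs, mul_nonneg hq (by linarith : 0 ≤ S - 2 * a - s)]
  by_contra! hlt
  have hS : 2 * a ≤ S := by linarith
  nlinarith

theorem ear_excess_le {S a c d : ℝ} (ha : 0 < a) (hac : a ≤ c) (had : a ≤ d)
    (hm : 0 < S - a - c) (hn : 0 < S - a - d) (h : a ≤ (5 - √5) / 10 * S) :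
    S + a + a ^ 2 * (S - a - c - d) / ((S - a - c) * (S - a - d)) ≤ 3 / √5 * S := by
  have h5 : √5 ^ 2 = 5 := Real.sq_sqrt (by norm_num)
  have h5' : 2.236 < √5 := by
    rw [Real.lt_sqrt (by norm_num)]; norm_num
  have h5'' : √5 < 2.237 := by
    rw [Real.sqrt_lt' (by norm_num)]; norm_num
  have hS : 3 * a ≤ S := by nlinarith
  have h3 : 3 / √5 = 3 * √5 / 5 := by
    rw [div_eq_div_iff (by positivity) (by norm_num)]; linear_combination -3 * h5
  have hk : 0 < S - 2 * a := by linarith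
  have hmono : (S - a - c - d) / ((S - a - c) * (S - a - d)) ≤ (S - 3 * a) / (S - 2 * a) ^ 2 := by
    rw [div_le_div_iff₀ (by positivity) (by positivity)]
    have h1 := mul_nonneg (mul_nonneg hk.le ha.le) (by linarith : 0 ≤ (c - a) + (d - a))
    have h2 := mul_nonneg (mul_nonneg (sub_nonneg.2 hac) (sub_nonneg.2 had)) (sub_nonneg.2 hS)
    linear_combination h1 + h2
  have hbound : a + a ^ 2 * ((S - 3 * a) / (S - 2 * a) ^ 2) ≤ (3 * √5 / 5 - 1) * S := by
    have h1 : 0 ≤ a ^ 2 - (5 * √5 - 3) / 2 * a * S + (√5 - 1) * S ^ 2 := by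
      have : 0 ≤ S := by linarith
      nlinarith [sq_nonneg a, mul_nonneg this (sub_nonneg.2 h), mul_nonneg ha.le this]
    have h2 := mul_nonneg (sub_nonneg.2 h) h1
    rw [← sub_nonneg]
    have : (3 * √5 / 5 - 1) * S - (a + a ^ 2 * ((S - 3 * a) / (S - 2 * a) ^ 2)) =
        ((5 - √5) / 10 * S - a) * (a ^ 2 - (5 * √5 - 3) / 2 * a * S + (√5 - 1) * S ^ 2) /
          (S - 2 * a) ^ 2 := by
      rw [eq_div_iff (by positivity)]
      have hc : (S - 3 * a) / (S - 2 * a) ^ 2 * (S - 2 * a) ^ 2 = S - 3 * a :=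
        div_mul_cancel₀ _ (by positivity)
      linear_combination (-a ^ 2) * hc + (S ^ 3 / 10 - a * S ^ 2 / 4) * h5
    rw [this]
    positivity
  rw [h3]
  have := mul_le_mul_of_nonneg_left hmono (sq_nonneg a)
  rw [← mul_div_assoc] at this
  linarith

/-- Cutting off the edge at the vertex `a` by a parallel to the diagonal `e b`: the quadrilateral
bounded by that parallel and the lines `b c`, `c d`, `d e`. -/
theorem exists_quad_of_pentagon {a b c d e : ℝ × ℝ} (habc : 0 < orient a b c)
    (habe : 0 < orient a b e) (hade : 0 < orient a d e) (hbcd : 0 < orient b c d)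
    (hbce : 0 < orient b c e) (hbde : 0 < orient b d e) (hcde : 0 < orient c d e) :
    ∃ y z : ℝ × ℝ, {a, b, c, d, e} ⊆ convexHull ℝ {y, c, d, z} ∧
      volume (convexHull ℝ {y, c, d, z}) = ENNReal.ofReal
        ((orient a b c + orient a c d + orient a d e + orient a b e + orient a b e ^ 2 *
          (orient b c e - orient b c d) / (orient b c e * orient b d e)) / 2) := by
  have hm := hbce.ne'
  have hn := hbde.ne'
  set s := orient a b e / orient b c e with hs
  set t := orient a b e / orient b d e with ht
  have hs0 : 0 < s := by positivity
  have ht0 : 0 < t := by positivity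
  let y : ℝ × ℝ := (b.1 + s * (b.1 - c.1), b.2 + s * (b.2 - c.2))
  let z : ℝ × ℝ := (e.1 + t * (e.1 - d.1), e.2 + t * (e.2 - d.2))
  have hsum : 0 < orient a b c * orient b d e + orient a d e * orient b c e := by positivity
  have hay : a = (orient a d e * orient b c e /
        (orient a b c * orient b d e + orient a d e * orient b c e)) • y +
      (orient a b c * orient b d e /
        (orient a b c * orient b d e + orient a d e * orient b c e)) • z := by
    refine Prod.ext ?_ ?_ <;>
    · simp only [Prod.fst_add, Prod.snd_add, Prod.smul_fst, Prod.smul_snd, smul_eq_mul, y, z, hs, ht]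
      field_simp
      simp only [orient]
      ring
  have hbcz : orient b c z = (orient a b c * orient b d e + orient a d e * orient b c e) /
      orient b d e := by
    rw [eq_div_iff hn]
    have : orient b c z = orient b c e + t * (orient b c e - orient b c d) := by
      simp only [orient, z]; ring
    rw [this, add_mul, mul_right_comm, ht, div_mul_cancel₀ _ hn]
    simp only [orient]; ring
  have hyde : orient y d e = (orient a b c * orient b d e + orient a d e * orient b c e) /
      orient b c e := by
    rw [eq_div_iff hm]
    have : orient y d e = orient b d e + s * (orient b d e - orient c d e) := by
      simp only [orient, y]; ring
    rw [this, add_mul, mul_right_comm, hs, div_mul_cancel₀ _ hm]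
    simp only [orient]; ring
  have hycd : orient y c d = (1 + s) * orient b c d := by simp only [orient, y]; ring
  have hcdz : orient c d z = (1 + t) * orient c d e := by simp only [orient, z]; ring
  have hycz : orient y c z = (1 + s) * orient b c z := by
    have : ∀ w, orient y c w = (1 + s) * orient b c w := fun w => by simp only [orient, y]; ring
    exact this z
  have hydz : orient y d z = (1 + t) * orient y d e := by
    have : ∀ w, orient w d z = (1 + t) * orient w d e := fun w => by simp only [orient, z]; ring
    exact this y
  refine ⟨y, z, ?_, ?_⟩
  · have hsub := subset_convexHull ℝ ({y, c, d, z} : Set (ℝ × ℝ))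
    have hy := hsub (by simp : y ∈ _)
    have hc := hsub (by simp : c ∈ _)
    have hd := hsub (by simp : d ∈ _)
    have hz := hsub (by simp : z ∈ _)
    have hconv := convex_convexHull ℝ ({y, c, d, z} : Set (ℝ × ℝ))
    rintro x (rfl | rfl | rfl | rfl | rfl)
    · rw [hay]
      exact hconv hy hz (by positivity) (by positivity) (by field_simp; ring)
    · refine hconv.segment_subset hc hy (mem_segment_of_smul one_pos
        (by linarith : 1 ≤ 1 + s) ?_ ?_) <;> simp only [y] <;> ring
    · exact hc
    · exact hd
    · refine hconv.segment_subset hd hz (mem_segment_of_smul one_pos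
        (by linarith : 1 ≤ 1 + t) ?_ ?_) <;> simp only [z] <;> ring
  · rw [volume_convexHull_quad (by rw [hycd]; positivity) (by rw [hycz, hbcz]; positivity)
      (by rw [hydz, hyde]; positivity) (by rw [hcdz]; positivity), hydz, hyde, hycd]
    congr 2
    rw [hs, ht]
    field_simp
    simp only [orient]
    ring

theorem exists_quad_of_min_ear {a b c d e : ℝ × ℝ} {P : Set (ℝ × ℝ)}
    (hP : P = convexHull ℝ {a, b, c, d, e}) (h_nonempty : (interior P).Nonempty)
    (habc : 0 < orient a b c)
    (habd : 0 < orient a b d) (habe : 0 < orient a b e) (hacd : 0 < orient a c d)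
    (hace : 0 < orient a c e) (hade : 0 < orient a d e) (hbcd : 0 < orient b c d)
    (hbce : 0 < orient b c e) (hbde : 0 < orient b d e) (hcde : 0 < orient c d e)
    (h₁ : orient e a b ≤ orient a b c) (h₂ : orient e a b ≤ orient b c d)
    (h₃ : orient e a b ≤ orient c d e) (h₄ : orient e a b ≤ orient d e a) :
    ∃ Q, IsConvexPolygon 4 Q ∧ P ⊆ Q ∧
      (volume Q).toReal ≤ 3 / √5 * (volume P).toReal := by
  obtain ⟨y, z, hsub, hvol⟩ := exists_quad_of_pentagon habc habe hade hbcd hbce hbde hcde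
  have hPQ : P ⊆ convexHull ℝ {y, c, d, z} := hP ▸ convexHull_min hsub (convex_convexHull ℝ _)
  refine ⟨_, ⟨{y, c, d, z}, Finset.card_le_four, by push_cast; rfl,
    h_nonempty.mono (interior_mono hPQ)⟩, hPQ, ?_⟩
  have hmin := min_ear_le h₁ h₂ h₃ h₄
    (S := orient a b c + orient a c d + orient a d e)
    (by simp only [orient] at *; linarith) (by simp only [orient] at *; linarith)
    (by simp only [orient] at *; linarith) (by simp only [orient] at *; linarith)
    (by simp only [orient] at *; linarith) (gauss_pentagon a b c d e)
  have heab : orient e a b = orient a b e := by simp only [orient]; ring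
  have hm : orient a b c + orient a c d + orient a d e - orient e a b - orient c d e =
      orient b c e := by simp only [orient]; ring
  have hn : orient a b c + orient a c d + orient a d e - orient e a b - orient b c d =
      orient b d e := by simp only [orient]; ring
  have hle := ear_excess_le (by linarith) h₃ h₂ (by linarith) (by linarith) hmin
  rw [hm, hn, heab] at hle
  rw [hvol, hP, volume_convexHull_pentagon habc habd habe hacd hace hade hbcd hbce hbde hcde,
    ENNReal.toReal_ofReal', ENNReal.toReal_ofReal (by positivity)]
  exact max_le (by linarith) (by positivity)

theorem exists_quad_of_isPosOriented {V : Fin 5 → ℝ × ℝ} (hV : IsPosOriented V) {P : Set (ℝ × ℝ)}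
    (hP : P = convexHull ℝ (Set.range V)) (h_nonempty : (interior P).Nonempty) :
    ∃ Q, IsConvexPolygon 4 Q ∧ P ⊆ Q ∧
      (volume Q).toReal ≤ 3 / √5 * (volume P).toReal := by
  have hrange : ∀ i : Fin 5, Set.range V = {V i, V (i + 1), V (i + 2), V (i + 3), V (i + 4)} := by
    intro i
    ext x
    simp only [Set.mem_range, Set.mem_insert_iff, Set.mem_singleton_iff, eq_comm (a := x)]
    constructor
    · rintro ⟨j, hj⟩
      have : ∀ i j : Fin 5, j = i ∨ j = i + 1 ∨ j = i + 2 ∨ j = i + 3 ∨ j = i + 4 := by decide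
      rcases this i j with rfl | rfl | rfl | rfl | rfl <;> tauto
    · rintro (h | h | h | h | h) <;> exact ⟨_, h⟩
  have h₁ : ∀ i : Fin 5, 0 < orient (V i) (V (i + 1)) (V (i + 2)) := by
    intro i
    fin_cases i
    · exact hV 0 1 2 (by decide) (by decide)
    · exact hV 1 2 3 (by decide) (by decide)
    · exact hV 2 3 4 (by decide) (by decide)
    · exact (hV 0 3 4 (by decide) (by decide)).trans_eq (orient_rotate (V 0) (V 3) (V 4)).symm
    · exact (hV 0 1 4 (by decide) (by decide)).trans_eq (orient_rotate (V 4) (V 0) (V 1))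
  have h₂ : ∀ i : Fin 5, 0 < orient (V i) (V (i + 1)) (V (i + 3)) := by
    intro i
    fin_cases i
    · exact hV 0 1 3 (by decide) (by decide)
    · exact hV 1 2 4 (by decide) (by decide)
    · exact (hV 0 2 3 (by decide) (by decide)).trans_eq (orient_rotate (V 0) (V 2) (V 3)).symm
    · exact (hV 1 3 4 (by decide) (by decide)).trans_eq (orient_rotate (V 1) (V 3) (V 4)).symm
    · exact (hV 0 2 4 (by decide) (by decide)).trans_eq (orient_rotate (V 4) (V 0) (V 2))
  obtain ⟨i, hi⟩ := Finite.exists_min fun i : Fin 5 => orient (V (i + 4)) (V i) (V (i + 1))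
  have e : ∀ k l : Fin 5, i + k + l = i + (k + l) := add_assoc i
  have habe := h₁ (i + 4)
  have hacd := h₂ (i + 2)
  have hace := h₂ (i + 4)
  have hade := h₁ (i + 3)
  have hbcd := h₁ (i + 1)
  have hbce := h₂ (i + 1)
  have hbde := h₂ (i + 3)
  have hcde := h₁ (i + 2)
  have h₁₁ := hi (i + 1)
  have h₁₂ := hi (i + 2)
  have h₁₃ := hi (i + 3)
  have h₁₄ := hi (i + 4)
  simp only [e, Fin.reduceAdd, Fin.isValue, add_zero] at *
  refine exists_quad_of_min_ear (hrange i ▸ hP) h_nonempty (h₁ i) (h₂ i)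
    (habe.trans_eq (orient_rotate _ _ _).symm) (hacd.trans_eq (orient_rotate _ _ _))
    (hace.trans_eq (orient_rotate _ _ _).symm) (hade.trans_eq (orient_rotate _ _ _)) hbcd hbce
    (hbde.trans_eq (orient_rotate _ _ _)) hcde h₁₁ h₁₂ h₁₃ h₁₄

theorem one_le_three_div_sqrt_five : 1 ≤ 3 / √5 := by
  rw [one_le_div (by positivity), Real.sqrt_le_left (by norm_num)]
  norm_num

theorem exists_quad_of_isConvexPolygon_five {P : Set (ℝ × ℝ)} (hP : IsConvexPolygon 5 P) :
    ∃ Q, IsConvexPolygon 4 Q ∧ P ⊆ Q ∧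
      (volume Q).toReal ≤ 3 / √5 * (volume P).toReal := by
  obtain ⟨S, hS, rfl, h_nonempty⟩ := hP
  obtain ⟨T, hTS, hTeq, hT⟩ := exists_subset_convexHull_eq S
  rw [← hTeq] at h_nonempty ⊢
  obtain hcard | hcard : T.card ≤ 4 ∨ T.card = 4 + 1 := by
    have := (Finset.card_le_card hTS).trans hS
    omega
  · exact ⟨_, ⟨T, hcard, rfl, h_nonempty⟩, subset_rfl,
      le_mul_of_one_le_left ENNReal.toReal_nonneg one_le_three_div_sqrt_five⟩
  · obtain ⟨V, hVT, hV⟩ := exists_isPosOriented hcard hT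
    exact exists_quad_of_isPosOriented hV (by rw [hVT]) h_nonempty

theorem volume_pos_of_isConvexPolygon {n : ℕ} {P : Set (ℝ × ℝ)} (hP : IsConvexPolygon n P) :
    0 < (volume P).toReal := by
  obtain ⟨S, -, rfl, h_nonempty⟩ := hP
  exact ENNReal.toReal_pos (Measure.measure_pos_of_nonempty_interior _ h_nonempty).ne'
    (S.finite_toSet.isCompact_convexHull ℝ).measure_ne_top

theorem interior_convexHull_eq_empty {T : Finset (ℝ × ℝ)} (hT : T.card ≤ 2) :
    interior (convexHull ℝ (T : Set (ℝ × ℝ))) = ∅ := by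
  obtain h | h | h : T.card = 0 ∨ T.card = 1 ∨ T.card = 2 := by omega
  · simp [Finset.card_eq_zero.1 h]
  · obtain ⟨x, rfl⟩ := Finset.card_eq_one.1 h
    simp
  · obtain ⟨x, y, hxy, rfl⟩ := Finset.card_eq_two.1 h
    refine Set.not_nonempty_iff_eq_empty.1 fun hne =>
      (Measure.measure_pos_of_nonempty_interior volume hne).ne' ?_
    refine measure_mono_null (fun q hq => ?_) (volume_setOf_orient_eq_zero hxy)
    have h₁ : 0 ≤ orient x y q := orient_nonneg_of_mem_convexHull (by simp [orient_self_left, orient_self_right]) hq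
    have h₂ : 0 ≤ orient y x q := orient_nonneg_of_mem_convexHull (by simp [orient_self_left, orient_self_right]) hq
    rw [orient_swap] at h₂
    exact le_antisymm (by linarith) h₁

/-- A convex quadrilateral is cut out by its (possibly degenerate) sides `a b`, `b c`, `c d`,
`d a`. -/
theorem exists_sides_of_isConvexPolygon_four {Q : Set (ℝ × ℝ)} (hQ : IsConvexPolygon 4 Q) :
    ∃ a b c d : ℝ × ℝ, (∀ q ∈ Q, 0 ≤ orient a b q ∧ 0 ≤ orient b c q ∧ 0 ≤ orient c d q ∧
      0 ≤ orient d a q) ∧ (volume Q).toReal = (orient a b c + orient a c d) / 2 := by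
  obtain ⟨S, hS, rfl, h_nonempty⟩ := hQ
  obtain ⟨T, hTS, hTeq, hT⟩ := exists_subset_convexHull_eq S
  rw [← hTeq] at h_nonempty ⊢
  obtain hcard | hcard | hcard : T.card ≤ 2 ∨ T.card = 2 + 1 ∨ T.card = 3 + 1 := by
    have := (Finset.card_le_card hTS).trans hS
    omega
  · exact absurd (interior_convexHull_eq_empty hcard) h_nonempty.ne_empty
  · obtain ⟨V, hVT, hV⟩ := exists_isPosOriented hcard hT
    have h := hV 0 1 2 (by decide) (by decide)
    have hrange : (T : Set (ℝ × ℝ)) = {V 0, V 1, V 2} := by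
      rw [← hVT]
      ext x
      simp [Fin.exists_fin_succ, eq_comm (a := x)]
    refine ⟨V 0, V 1, V 2, V 2, fun q hq => ?_, ?_⟩
    · rw [hrange, mem_convexHull_triple_iff h] at hq
      exact ⟨hq.1, hq.2.1, by simp [orient], hq.2.2⟩
    · rw [hrange, volume_convexHull_triple h, ENNReal.toReal_ofReal (by positivity),
        orient_self_right, add_zero]
  · obtain ⟨V, hVT, hV⟩ := exists_isPosOriented hcard hT
    have h₁ := hV 0 1 2 (by decide) (by decide)
    have h₂ := hV 0 1 3 (by decide) (by decide)
    have h₃ := hV 0 2 3 (by decide) (by decide)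
    have h₄ := hV 1 2 3 (by decide) (by decide)
    have hrange : (T : Set (ℝ × ℝ)) = {V 0, V 1, V 2, V 3} := by
      rw [← hVT]
      ext x
      simp [Fin.exists_fin_succ, eq_comm (a := x)]
    rw [hrange]
    refine ⟨V 0, V 1, V 2, V 3, fun q hq => ⟨?_, ?_, ?_, ?_⟩, ?_⟩
    · refine orient_nonneg_of_mem_convexHull ?_ hq
      simp [orient_self_left, orient_self_right, h₁.le, h₂.le]
    · refine orient_nonneg_of_mem_convexHull ?_ hq
      simp [orient_self_left, orient_self_right, h₄.le, orient_rotate (V 0) (V 1) (V 2), h₁.le]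
    · refine orient_nonneg_of_mem_convexHull ?_ hq
      have := h₃.trans_eq (orient_rotate _ _ _).symm
      have := h₄.trans_eq (orient_rotate _ _ _).symm
      simp [orient_self_left, orient_self_right, *, le_of_lt]
    · refine orient_nonneg_of_mem_convexHull ?_ hq
      have := h₂.trans_eq (orient_rotate _ _ _)
      have := h₃.trans_eq (orient_rotate _ _ _)
      simp [orient_self_left, orient_self_right, *, le_of_lt]
    · rw [volume_convexHull_quad h₁ h₂ h₃ h₄, ENNReal.toReal_ofReal (by positivity)]

/-- The cross product of two plane vectors. -/
def cross (u v : ℝ × ℝ) : ℝ := u.1 * v.2 - u.2 * v.1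

theorem exists_nonneg_combination {p q v : ℝ × ℝ} (hpq : 0 < cross p q) (hp : 0 ≤ cross p v)
    (hq : 0 ≤ cross v q) : ∃ x y : ℝ, 0 ≤ x ∧ 0 ≤ y ∧ v = x • p + y • q := by
  refine ⟨cross v q / cross p q, cross p v / cross p q, by positivity, by positivity, ?_⟩
  have h := hpq.ne'
  refine Prod.ext ?_ ?_ <;>
  · simp only [Prod.fst_add, Prod.snd_add, Prod.smul_fst, Prod.smul_snd, smul_eq_mul]
    field_simp
    simp only [cross]
    ring

/-- An affine image of the regular pentagon; `t` will be the inverse of the golden ratio. -/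
def affinePentagon (t : ℝ) : Set (ℝ × ℝ) :=
  convexHull ℝ {(1, 0), (0, 1), (-1, t), (-t, -t), (t, -1)}

theorem mem_affinePentagon_of_segment {t s : ℝ} {p q x : ℝ × ℝ} (hp : p ∈ affinePentagon t)
    (hq : q ∈ affinePentagon t) (hs : 0 ≤ s) (hs' : s ≤ 1) (h₁ : x.1 = (1 - s) * p.1 + s * q.1)
    (h₂ : x.2 = (1 - s) * p.2 + s * q.2) : x ∈ affinePentagon t :=
  (convex_convexHull ℝ _).segment_subset hp hq
    ⟨1 - s, s, by linarith, hs, by ring, (Prod.ext h₁ h₂).symm⟩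

theorem mem_affinePentagon_vertex (t : ℝ) :
    (1, 0) ∈ affinePentagon t ∧ (0, 1) ∈ affinePentagon t ∧ (-1, t) ∈ affinePentagon t ∧
      (-t, -t) ∈ affinePentagon t ∧ (t, -1) ∈ affinePentagon t := by
  refine ⟨?_, ?_, ?_, ?_, ?_⟩ <;> exact subset_convexHull ℝ _ (by simp)

/-- `a`, `b`, `c`, `d` are the vertices of a quadrilateral of positive area whose sides leave the
pentagon on their left. -/
structure Encloses (t : ℝ) (a b c d : ℝ × ℝ) : Prop where
  sides : ∀ q ∈ affinePentagon t, 0 ≤ orient a b q ∧ 0 ≤ orient b c q ∧ 0 ≤ orient c d q ∧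
    0 ≤ orient d a q
  pos : 0 < cross (c - a) (d - b)

theorem Encloses.le_cross {t : ℝ} {a b c d : ℝ × ℝ} (h : Encloses t a b c d)
    {q₀ q₁ q₂ q₃ : ℝ × ℝ} (h₀ : q₀ ∈ affinePentagon t) (h₁ : q₁ ∈ affinePentagon t)
    (h₂ : q₂ ∈ affinePentagon t) (h₃ : q₃ ∈ affinePentagon t) (hq : q₀ = q₁ - q₂ + q₃) :
    cross (q₁ - q₂) (c - a) + cross (q₂ - q₃) (d - b) ≤ cross (c - a) (d - b) := by
  have H₀ := (h.sides _ h₀).1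
  have H₁ := (h.sides _ h₁).2.1
  have H₂ := (h.sides _ h₂).2.2.1
  have H₃ := (h.sides _ h₃).2.2.2
  subst hq
  simp only [orient, cross, Prod.fst_add, Prod.snd_add, Prod.fst_sub, Prod.snd_sub] at *
  linarith

section Forms

variable {t α p q w : ℝ}

theorem form_two_nonneg (ht : t ^ 2 = 1 - t) (ht₁ : 3 / 5 ≤ t) (ht₂ : t ≤ 5 / 8) (hα : 0 ≤ α)
    (hp : 0 ≤ p) (hw : 0 ≤ w) :
    0 ≤ (8 - 12 * t) * α ^ 2 + (5 * t - 4) * α * q + (8 * t - 4) * α * p +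
      (12 - 19 * t) * α * w + (1 - t) * q ^ 2 + (t - 1) * q * p + (3 * t - 2) * q * w +
      (1 - t) * p ^ 2 + (3 * t - 2) * p * w + (5 - 8 * t) * w ^ 2 := by
  have c₁ : 0 ≤ 1 - t := by linarith
  have c₂ : 0 ≤ 15 / 4 - 6 * t := by linarith
  have c₃ : 0 ≤ 21 / 2 * t - 6 := by linarith
  have c₄ : 0 ≤ 15 / 2 - 12 * t := by linarith
  have key : 0 ≤ (1 - t) * (q - (p + (1 - t) * w) / 2 - (3 - t) / 2 * α) ^ 2 +
      3 / 4 * (1 - t) * (p - (1 - t) * w) ^ 2 + (15 / 4 - 6 * t) * α ^ 2 +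
      (21 / 2 * t - 6) * α * p + (15 / 2 - 12 * t) * α * w := by positivity
  linear_combination key - (-2 * α ^ 2 + 1/4 * α ^ 2 * t - 1/2 * α * p + α * q + 1/2 * α * t * w
    - 3 * α * w + p * w + q * w + t * w ^ 2 - 4 * w ^ 2) * ht

theorem form_one_nonneg (ht : t ^ 2 = 1 - t) (ht₁ : 3 / 5 ≤ t) (ht₂ : t ≤ 5 / 8) (hα : 0 ≤ α)
    (hp : 0 ≤ p) (hq : 0 ≤ q) (hw : 0 ≤ w) :
    0 ≤ (8 - 12 * t) * α ^ 2 + (5 - 9 * t) * α * q + (8 * t - 4) * α * p +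
      (12 - 19 * t) * α * w + (2 - 3 * t) * q ^ 2 + (4 * t - 2) * q * p + (3 - 5 * t) * q * w +
      (1 - t) * p ^ 2 + (9 * t - 5) * p * w + (5 - 8 * t) * w ^ 2 := by
  have c₁ : 0 ≤ 1 - t := by linarith
  have c₂ : 0 ≤ 15 / 4 - 6 * t := by linarith
  have c₃ : 0 ≤ 8 * t - 4 := by linarith
  have c₄ : 0 ≤ 15 / 2 - 12 * t := by linarith
  have c₅ : 0 ≤ 2 - 3 * t := by linarith
  have c₆ : 0 ≤ 4 * t - 2 := by linarith
  have c₇ : 0 ≤ 9 * t - 5 := by linarith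
  have key : 0 ≤ (2 - 3 * t) * (q - t * w / 2 - (2 + 3 * t) / 2 * α) ^ 2 +
      (15 / 4 - 6 * t) * (α ^ 2 + w ^ 2) + (8 * t - 4) * α * p + (15 / 2 - 12 * t) * α * w +
      (1 - t) * p ^ 2 + (4 * t - 2) * p * q + (9 * t - 5) * p * w := by positivity
  linear_combination key - (-9/4 * α ^ 2 + 27/4 * α ^ 2 * t - 9 * α * q + 9/2 * α * t * w
    - 9/2 * α * w - 3 * q * w + 3/4 * t * w ^ 2 - 5/4 * w ^ 2) * ht

theorem form_zero_nonneg (ht₁ : 3 / 5 ≤ t) (ht₂ : t ≤ 5 / 8) (hα : 0 ≤ α)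
    (hp : 0 ≤ p) (hq : 0 ≤ q) (hw : 0 ≤ w) :
    0 ≤ (8 - 12 * t) * α ^ 2 + (20 * t - 12) * α * q + (8 * t - 4) * α * p +
      (21 - 33 * t) * α * w + (5 - 8 * t) * q ^ 2 + (7 - 9 * t) * q * p + (30 * t - 18) * q * w +
      (1 - t) * p ^ 2 + (12 * t - 6) * p * w + (15 - 24 * t) * w ^ 2 := by
  have c₁ : 0 ≤ 8 - 12 * t := by linarith
  have c₂ : 0 ≤ 20 * t - 12 := by linarith
  have c₃ : 0 ≤ 8 * t - 4 := by linarith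
  have c₄ : 0 ≤ 21 - 33 * t := by linarith
  have c₅ : 0 ≤ 5 - 8 * t := by linarith
  have c₆ : 0 ≤ 7 - 9 * t := by linarith
  have c₇ : 0 ≤ 30 * t - 18 := by linarith
  have c₈ : 0 ≤ 1 - t := by linarith
  have c₉ : 0 ≤ 12 * t - 6 := by linarith
  have c₁₀ : 0 ≤ 15 - 24 * t := by linarith
  positivity

end Forms

theorem le_of_form_nonneg {k D M d m : ℝ} (hk : 0 < k) (hD : 0 < D) (hMD : M ≤ D)
    (hDd : D = k * d) (hMm : M = k * m) (hm : 0 ≤ m) (h : 0 ≤ m ^ 2 - 3 * d) : 3 * k ≤ D := by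
  subst hDd hMm
  have hd : 0 < d := pos_of_mul_pos_right hD hk.le
  have hmd : m ≤ d := le_of_mul_le_mul_left hMD hk
  have : 3 ≤ d := by nlinarith
  rw [mul_comm]
  exact mul_le_mul_of_nonneg_left this hk.le

theorem Encloses.le_cross_of_sector_two {t : ℝ} {a b c d : ℝ × ℝ} (h : Encloses t a b c d)
    (ht : t ^ 2 = 1 - t) (ht₁ : 3 / 5 ≤ t) (ht₂ : t ≤ 5 / 8) {x₁ y₁ x₂ y₂ : ℝ} (hx₁ : 0 ≤ x₁)
    (hy₁ : 0 ≤ y₁) (hx₂ : 0 ≤ x₂) (hy₂ : 0 ≤ y₂)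
    (h₁ : c - a = x₁ • ((-1, 1) : ℝ × ℝ) + y₁ • ((-2 * t, 1 - t) : ℝ × ℝ))
    (h₂ : d - b = x₂ • ((-1, t - 1) : ℝ × ℝ) + y₂ • ((t - 1, -1) : ℝ × ℝ)) :
    3 * (2 * t + 1) ≤ cross (c - a) (d - b) := by
  obtain ⟨v₀, v₁, v₂, v₃, v₄⟩ := mem_affinePentagon_vertex t
  have hpos := h.pos
  have c₁ : 0 ≤ 1 - t := by linarith
  rcases le_total y₂ x₁ with hle | hle
  · obtain ⟨α, rfl⟩ : ∃ α, x₁ = y₂ + α := ⟨x₁ - y₂, by ring⟩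
    have hα : 0 ≤ α := by linarith
    have w₂ : (1 - 3 * t, 2 - 3 * t) ∈ affinePentagon t :=
      mem_affinePentagon_of_segment v₂ v₃ (s := 1 - t) (by linarith) (by linarith)
        (by linear_combination -ht)
        (by linear_combination -2 * ht)
    have w₃ : (2 - 3 * t, 1 - 3 * t) ∈ affinePentagon t :=
      mem_affinePentagon_of_segment v₃ v₄ (s := t) (by linarith) (by linarith)
        (by linear_combination -2 * ht)
        (by linear_combination -ht)
    have hM := h.le_cross v₀ v₁ w₂ w₃ (by ext <;> simp <;> ring)
    rw [h₁, h₂] at hM hpos ⊢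
    refine le_of_form_nonneg (by linarith) hpos hM
      (d := t * ((y₂ + α) * x₂ + (y₂ + α) * y₂ + y₁ * y₂) + (1 - t) * y₁ * x₂)
      (m := 2 * (1 - t) * (y₂ + α) + t * (y₁ + x₂ + y₂)) ?_ ?_ (by positivity) ?_
    · simp only [cross, Prod.fst_add, Prod.snd_add, Prod.smul_mk, smul_eq_mul]
      linear_combination (-2 * x₂ * y₂ - 2 * x₂ * α - y₁ * y₂ - 2 * y₂ ^ 2 - 2 * y₂ * α) * ht
    · simp only [cross, Prod.fst_add, Prod.snd_add, Prod.fst_sub, Prod.snd_sub, Prod.smul_mk,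
        smul_eq_mul]
      linear_combination (-2 * x₂ + y₁ + 2 * y₂ + 4 * α) * ht
    · have hform := form_two_nonneg ht ht₁ ht₂ hα hy₁ hy₂ (q := x₂)
      linear_combination hform - (x₂ ^ 2 + 2 * x₂ * y₁ - 2 * x₂ * y₂ - 4 * x₂ * α + y₁ ^ 2 - 2 *
        y₁ * y₂ - 4 * y₁ * α + y₂ ^ 2 + 4 * y₂ * α + 4 * α ^ 2) * ht
  · obtain ⟨α, rfl⟩ : ∃ α, y₂ = x₁ + α := ⟨y₂ - x₁, by ring⟩
    have hα : 0 ≤ α := by linarith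
    have w₁ : (-1 + t, -1 + 3 * t) ∈ affinePentagon t :=
      mem_affinePentagon_of_segment v₁ v₂ (s := 1 - t) (by linarith) (by linarith)
        (by ring)
        (by linear_combination ht)
    have w₂ : (-2 + 2 * t, -2 + 3 * t) ∈ affinePentagon t :=
      mem_affinePentagon_of_segment v₂ v₃ (s := t) (by linarith) (by linarith)
        (by linear_combination ht)
        (by linear_combination (2) * ht)
    have hM := h.le_cross v₀ w₁ w₂ v₄ (by ext <;> simp <;> ring)
    rw [h₁, h₂] at hM hpos ⊢
    refine le_of_form_nonneg (by linarith) hpos hM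
      (d := t * (x₁ * x₂ + x₁ * (x₁ + α) + y₁ * (x₁ + α)) + (1 - t) * y₁ * x₂)
      (m := 2 * (1 - t) * (x₁ + α) + t * (y₁ + x₂ + x₁)) ?_ ?_ (by positivity) ?_
    · simp only [cross, Prod.fst_add, Prod.snd_add, Prod.smul_mk, smul_eq_mul]
      linear_combination (-2 * x₁ ^ 2 - 2 * x₁ * x₂ - x₁ * y₁ - 2 * x₁ * α - y₁ * α) * ht
    · simp only [cross, Prod.fst_add, Prod.snd_add, Prod.fst_sub, Prod.snd_sub, Prod.smul_mk,
        smul_eq_mul]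
      linear_combination (-x₁ - x₂ - y₁ + α) * ht
    · have hform := form_two_nonneg ht ht₁ ht₂ hα hx₂ hx₁ (q := y₁)
      linear_combination hform - (x₁ ^ 2 - 2 * x₁ * x₂ - 2 * x₁ * y₁ + 4 * x₁ * α + x₂ ^ 2 + 2 *
        x₂ * y₁ - 4 * x₂ * α + y₁ ^ 2 - 4 * y₁ * α + 4 * α ^ 2) * ht

theorem Encloses.le_cross_of_sector_one {t : ℝ} {a b c d : ℝ × ℝ} (h : Encloses t a b c d)
    (ht : t ^ 2 = 1 - t) (ht₁ : 3 / 5 ≤ t) (ht₂ : t ≤ 5 / 8) {x₁ y₁ x₂ y₂ : ℝ} (hx₁ : 0 ≤ x₁)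
    (hy₁ : 0 ≤ y₁) (hx₂ : 0 ≤ x₂) (hy₂ : 0 ≤ y₂)
    (h₁ : c - a = x₁ • ((-1, 1) : ℝ × ℝ) + y₁ • ((-2 * t, 1 - t) : ℝ × ℝ))
    (h₂ : d - b = x₂ • ((-2 * t, 1 - t) : ℝ × ℝ) + y₂ • ((-1, t - 1) : ℝ × ℝ)) :
    3 * (2 * t + 1) ≤ cross (c - a) (d - b) := by
  obtain ⟨v₀, v₁, v₂, v₃, v₄⟩ := mem_affinePentagon_vertex t
  have hpos := h.pos
  have c₁ : 0 ≤ 1 - t := by linarith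
  rcases le_total y₂ x₁ with hle | hle
  · obtain ⟨α, rfl⟩ : ∃ α, x₁ = y₂ + α := ⟨x₁ - y₂, by ring⟩
    have hα : 0 ≤ α := by linarith
    have w₂ : (1 - 3 * t, 2 - 3 * t) ∈ affinePentagon t :=
      mem_affinePentagon_of_segment v₂ v₃ (s := 1 - t) (by linarith) (by linarith)
        (by linear_combination -ht)
        (by linear_combination -2 * ht)
    have w₃ : (2 - 3 * t, 1 - 3 * t) ∈ affinePentagon t :=
      mem_affinePentagon_of_segment v₃ v₄ (s := t) (by linarith) (by linarith)
        (by linear_combination -2 * ht)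
        (by linear_combination -ht)
    have hM := h.le_cross v₀ v₁ w₂ w₃ (by ext <;> simp <;> ring)
    rw [h₁, h₂] at hM hpos ⊢
    refine le_of_form_nonneg (by linarith) hpos hM
      (d := (1 - t) * (y₂ + α) * x₂ + t * (y₂ + α) * y₂ + (1 - t) * y₁ * y₂)
      (m := 2 * (1 - t) * (y₂ + α) + t * y₁ + (1 - t) * x₂ + t * y₂) ?_ ?_ (by positivity) ?_
    · simp only [cross, Prod.fst_add, Prod.snd_add, Prod.smul_mk, smul_eq_mul]
      linear_combination (2 * x₂ * y₂ + 2 * x₂ * α - 2 * y₂ ^ 2 - 2 * y₂ * α) * ht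
    · simp only [cross, Prod.fst_add, Prod.snd_add, Prod.fst_sub, Prod.snd_sub, Prod.smul_mk,
        smul_eq_mul]
      linear_combination (2 * x₂ + y₁ + 2 * y₂ + 4 * α) * ht
    · have hform := form_one_nonneg ht ht₁ ht₂ hα hy₁ hx₂ hy₂
      linear_combination hform - (x₂ ^ 2 - 2 * x₂ * y₁ + 2 * x₂ * y₂ + 4 * x₂ * α + y₁ ^ 2 - 2 *
        y₁ * y₂ - 4 * y₁ * α + y₂ ^ 2 + 4 * y₂ * α + 4 * α ^ 2) * ht
  · obtain ⟨α, rfl⟩ : ∃ α, y₂ = x₁ + α := ⟨y₂ - x₁, by ring⟩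
    have hα : 0 ≤ α := by linarith
    have w₀ : (-1 + 3 * t, -1 + t) ∈ affinePentagon t :=
      mem_affinePentagon_of_segment v₄ v₀ (s := t) (by linarith) (by linarith)
        (by linear_combination ht)
        (by ring)
    have w₃ : (-2 + 3 * t, -2 + 2 * t) ∈ affinePentagon t :=
      mem_affinePentagon_of_segment v₃ v₄ (s := 1 - t) (by linarith) (by linarith)
        (by linear_combination (2) * ht)
        (by linear_combination ht)
    have hM := h.le_cross w₀ v₁ v₂ w₃ (by ext <;> simp <;> ring)
    rw [h₁, h₂] at hM hpos ⊢
    refine le_of_form_nonneg (by linarith) hpos hM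
      (d := (1 - t) * x₁ * x₂ + t * x₁ * (x₁ + α) + (1 - t) * y₁ * (x₁ + α))
      (m := t * x₁ + (1 - t) * y₁ + t * x₂ + 2 * (1 - t) * (x₁ + α)) ?_ ?_ (by positivity) ?_
    · simp only [cross, Prod.fst_add, Prod.snd_add, Prod.smul_mk, smul_eq_mul]
      linear_combination (-2 * x₁ ^ 2 + 2 * x₁ * x₂ - 2 * x₁ * α) * ht
    · simp only [cross, Prod.fst_add, Prod.snd_add, Prod.fst_sub, Prod.snd_sub, Prod.smul_mk,
        smul_eq_mul]
      linear_combination (-x₁ - x₂ + α) * ht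
    · have hform := form_one_nonneg ht ht₁ ht₂ hα hx₂ hy₁ hx₁
      linear_combination hform - (x₁ ^ 2 - 2 * x₁ * x₂ + 2 * x₁ * y₁ + 4 * x₁ * α + x₂ ^ 2 - 2 *
        x₂ * y₁ - 4 * x₂ * α + y₁ ^ 2 + 4 * y₁ * α + 4 * α ^ 2) * ht

theorem Encloses.le_cross_of_sector_zero {t : ℝ} {a b c d : ℝ × ℝ} (h : Encloses t a b c d)
    (ht : t ^ 2 = 1 - t) (ht₁ : 3 / 5 ≤ t) (ht₂ : t ≤ 5 / 8) {x₁ y₁ x₂ y₂ : ℝ} (hx₁ : 0 ≤ x₁)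
    (hy₁ : 0 ≤ y₁) (hx₂ : 0 ≤ x₂) (hy₂ : 0 ≤ y₂)
    (h₁ : c - a = x₁ • ((-1, 1) : ℝ × ℝ) + y₁ • ((-2 * t, 1 - t) : ℝ × ℝ))
    (h₂ : d - b = x₂ • ((-1, 1) : ℝ × ℝ) + y₂ • ((-2 * t, 1 - t) : ℝ × ℝ)) :
    3 * (2 * t + 1) ≤ cross (c - a) (d - b) := by
  obtain ⟨v₀, v₁, v₂, v₃, v₄⟩ := mem_affinePentagon_vertex t
  have hpos := h.pos
  have c₁ : 0 ≤ 1 - t := by linarith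
  have c₂ : 0 ≤ 2 * t - 1 := by linarith
  rcases le_total y₂ x₁ with hle | hle
  · obtain ⟨α, rfl⟩ : ∃ α, x₁ = y₂ + α := ⟨x₁ - y₂, by ring⟩
    have hα : 0 ≤ α := by linarith
    have w₀ : (-1 + 2 * t, -1 + 2 * t) ∈ affinePentagon t :=
      mem_affinePentagon_of_segment v₀ v₂ (s := 1 - t) (by linarith) (by linarith)
        (by ring)
        (by linear_combination ht)
    have w₂ : (1 - 3 * t, 2 - 3 * t) ∈ affinePentagon t :=
      mem_affinePentagon_of_segment v₂ v₃ (s := 1 - t) (by linarith) (by linarith)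
        (by linear_combination -ht)
        (by linear_combination -2 * ht)
    have hM := h.le_cross w₀ v₁ w₂ v₃ (by ext <;> simp <;> ring)
    rw [h₁, h₂] at hM hpos ⊢
    refine le_of_form_nonneg (by linarith) hpos hM
      (d := (1 - t) * ((y₂ + α) * y₂ - y₁ * x₂))
      (m := 2 * (1 - t) * (y₂ + α) + t * y₁ + (2 * t - 1) * x₂ + (1 - t) * y₂) ?_ ?_ (by positivity) ?_
    · simp only [cross, Prod.fst_add, Prod.snd_add, Prod.smul_mk, smul_eq_mul]
      linear_combination (-2 * x₂ * y₁ + 2 * y₂ ^ 2 + 2 * y₂ * α) * ht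
    · simp only [cross, Prod.fst_add, Prod.snd_add, Prod.fst_sub, Prod.snd_sub, Prod.smul_mk,
        smul_eq_mul]
      linear_combination (-4 * x₂ + y₁ + 4 * y₂ + 4 * α) * ht
    · have hform := form_zero_nonneg ht₁ ht₂ hα hy₁ hx₂ hy₂
      linear_combination hform - (4 * x₂ ^ 2 + 4 * x₂ * y₁ - 12 * x₂ * y₂ - 8 * x₂ * α + y₁ ^ 2 -
        6 * y₁ * y₂ - 4 * y₁ * α + 9 * y₂ ^ 2 + 12 * y₂ * α + 4 * α ^ 2) * ht
  · obtain ⟨α, rfl⟩ : ∃ α, y₂ = x₁ + α := ⟨y₂ - x₁, by ring⟩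
    have hα : 0 ≤ α := by linarith
    have w₀ : (0, -1 + t) ∈ affinePentagon t :=
      mem_affinePentagon_of_segment v₂ v₄ (s := t) (by linarith) (by linarith)
        (by linear_combination -ht)
        (by linear_combination ht)
    have w₂ : (-t, 2 - 2 * t) ∈ affinePentagon t :=
      mem_affinePentagon_of_segment v₁ v₂ (s := t) (by linarith) (by linarith)
        (by ring)
        (by linear_combination -ht)
    have hM := h.le_cross w₀ v₁ w₂ v₃ (by ext <;> simp; ring)
    rw [h₁, h₂] at hM hpos ⊢
    refine le_of_form_nonneg (by linarith) hpos hM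
      (d := (1 - t) * (x₁ * (x₁ + α) - y₁ * x₂))
      (m := (1 - t) * x₁ + (2 * t - 1) * y₁ + t * x₂ + 2 * (1 - t) * (x₁ + α)) ?_ ?_ (by positivity) ?_
    · simp only [cross, Prod.fst_add, Prod.snd_add, Prod.smul_mk, smul_eq_mul]
      linear_combination (2 * x₁ ^ 2 + 2 * x₁ * α - 2 * x₂ * y₁) * ht
    · simp only [cross, Prod.fst_add, Prod.snd_add, Prod.fst_sub, Prod.snd_sub, Prod.smul_mk,
        smul_eq_mul]
      linear_combination (4 * x₁ - 2 * x₂ - y₁ + 2 * α) * ht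
    · have hform := form_zero_nonneg ht₁ ht₂ hα hx₂ hy₁ hx₁
      linear_combination hform - (9 * x₁ ^ 2 - 6 * x₁ * x₂ - 12 * x₁ * y₁ + 12 * x₁ * α + x₂ ^ 2
        + 4 * x₂ * y₁ - 4 * x₂ * α + 4 * y₁ ^ 2 - 8 * y₁ * α + 4 * α ^ 2) * ht

/-- A linear map of determinant one permuting the vertices of `affinePentagon t` cyclically when
`t ^ 2 = 1 - t`. -/
def turn (t : ℝ) : (ℝ × ℝ) →ₗ[ℝ] ℝ × ℝ where
  toFun v := (-v.2, v.1 + t * v.2)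
  map_add' v w := by ext <;> simp <;> ring
  map_smul' k v := by ext <;> simp; ring

theorem turn_apply (t : ℝ) (v : ℝ × ℝ) : turn t v = (-v.2, v.1 + t * v.2) := rfl

theorem orient_turn (t : ℝ) (a b c : ℝ × ℝ) :
    orient (turn t a) (turn t b) (turn t c) = orient a b c := by
  simp only [orient, turn_apply]; ring

theorem cross_turn (t : ℝ) (u v : ℝ × ℝ) : cross (turn t u) (turn t v) = cross u v := by
  simp only [cross, turn_apply]; ring

theorem orient_turn_nonneg {t : ℝ} (ht : t ^ 2 = 1 - t) {a b : ℝ × ℝ}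
    (h : ∀ q ∈ affinePentagon t, 0 ≤ orient a b q) :
    ∀ q ∈ affinePentagon t, 0 ≤ orient (turn t a) (turn t b) q := by
  obtain ⟨v₀, v₁, v₂, v₃, v₄⟩ := mem_affinePentagon_vertex t
  have key : ∀ {p q : ℝ × ℝ}, p ∈ affinePentagon t → q = turn t p →
      0 ≤ orient (turn t a) (turn t b) q := fun hp hq => by
    rw [hq, orient_turn]
    exact h _ hp
  intro q hq
  refine orient_nonneg_of_mem_convexHull ?_ hq
  rintro p (rfl | rfl | rfl | rfl | rfl)
  · exact key v₄ (by simp [turn_apply])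
  · exact key v₀ (by simp [turn_apply])
  · exact key v₁ (by simp [turn_apply])
  · exact key v₂ (Prod.ext (by simp [turn_apply]) (by simp only [turn_apply]; linarith))
  · exact key v₃ (Prod.ext (by simp [turn_apply]) (by simp only [turn_apply]; linarith))

namespace Encloses

variable {t : ℝ} {a b c d : ℝ × ℝ}

theorem turn (ht : t ^ 2 = 1 - t) (h : Encloses t a b c d) :
    Encloses t (turn t a) (turn t b) (turn t c) (turn t d) where
  sides q hq :=
    ⟨orient_turn_nonneg ht (fun q hq => (h.sides q hq).1) q hq,
      orient_turn_nonneg ht (fun q hq => (h.sides q hq).2.1) q hq,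
      orient_turn_nonneg ht (fun q hq => (h.sides q hq).2.2.1) q hq,
      orient_turn_nonneg ht (fun q hq => (h.sides q hq).2.2.2) q hq⟩
  pos := by
    rw [← map_sub, ← map_sub, cross_turn]
    exact h.pos

theorem cross_shift (a b c d : ℝ × ℝ) : cross (d - b) (a - c) = cross (c - a) (d - b) := by
  simp only [cross, Prod.fst_sub, Prod.snd_sub]; ring

theorem shift (h : Encloses t a b c d) : Encloses t b c d a where
  sides q hq :=
    have ⟨h₁, h₂, h₃, h₄⟩ := h.sides q hq
    ⟨h₂, h₃, h₄, h₁⟩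
  pos := cross_shift a b c d ▸ h.pos

end Encloses

/-- The directions of the sides of `affinePentagon t` and their opposites, in cyclic order. -/
def ray (t : ℝ) : ℕ → ℝ × ℝ
  | 0 => (-1, 1)
  | 1 => (-2 * t, 1 - t)
  | 2 => (-1, t - 1)
  | 3 => (t - 1, -1)
  | 4 => (1 - t, -2 * t)
  | n + 5 => -ray t n

theorem ray_add_two {t : ℝ} (ht : t ^ 2 = 1 - t) : ∀ n, ray t (n + 2) = turn t (ray t n)
  | 0 => by ext <;> simp [ray, turn_apply]; ring
  | 1 => by ext <;> simp [ray, turn_apply]; linarith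
  | 2 => by ext <;> simp [ray, turn_apply]; linarith
  | 3 => by ext <;> simp [ray, turn_apply]; ring
  | 4 => by ext <;> simp [ray, turn_apply]; linarith
  | n + 5 => by
    change -ray t (n + 2) = turn t (-ray t n)
    rw [map_neg, ray_add_two ht n]

theorem cross_neg_left (u v : ℝ × ℝ) : cross (-u) v = -cross u v := by
  simp only [cross, Prod.fst_neg, Prod.snd_neg]; ring

theorem cross_swap (u v : ℝ × ℝ) : cross v u = -cross u v := by
  simp only [cross]; ring

theorem cross_ray_pos {t : ℝ} (ht : t ^ 2 = 1 - t) (ht₁ : 3 / 5 ≤ t) :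
    ∀ n, 0 < cross (ray t n) (ray t (n + 1))
  | 0 => by simp only [ray, cross]; linarith
  | 1 => by simp only [ray, cross]; linarith
  | n + 2 => by
    rw [ray_add_two ht, add_right_comm, ray_add_two ht, cross_turn]
    exact cross_ray_pos ht ht₁ n

theorem exists_sector {t : ℝ} (ht : t ^ 2 = 1 - t) (ht₁ : 3 / 5 ≤ t) {n : ℕ} {v : ℝ × ℝ}
    (hv : 0 ≤ cross (ray t n) v) : ∃ δ ≤ 4, ∃ x y : ℝ, 0 ≤ x ∧ 0 ≤ y ∧
      v = x • ray t (n + δ) + y • ray t (n + δ + 1) := by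
  obtain ⟨δ, hδ, h₁, h₂⟩ : ∃ δ ≤ 4, 0 ≤ cross (ray t (n + δ)) v ∧
      cross (ray t (n + δ + 1)) v ≤ 0 := by
    by_contra! h
    have h₁ := h 0 (by norm_num) hv
    have h₂ := h 1 (by norm_num) h₁.le
    have h₃ := h 2 (by norm_num) h₂.le
    have h₄ := h 3 (by norm_num) h₃.le
    have h₅ := h 4 (by norm_num) h₄.le
    rw [show n + 4 + 1 = n + 5 from rfl, ray, cross_neg_left] at h₅
    linarith
  exact ⟨δ, hδ, exists_nonneg_combination (cross_ray_pos ht ht₁ _) h₁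
    (by rw [cross_swap]; linarith)⟩

/-- The area bound for the quadrilaterals whose diagonals lie in the sectors spanned by the rays
`n`, `n + 1` and `n + δ`, `n + δ + 1`. -/
def SectorBound (t : ℝ) (δ n : ℕ) : Prop :=
  ∀ ⦃a b c d : ℝ × ℝ⦄, Encloses t a b c d → ∀ ⦃x₁ y₁ x₂ y₂ : ℝ⦄, 0 ≤ x₁ → 0 ≤ y₁ → 0 ≤ x₂ →
    0 ≤ y₂ → c - a = x₁ • ray t n + y₁ • ray t (n + 1) →
    d - b = x₂ • ray t (n + δ) + y₂ • ray t (n + δ + 1) →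
    3 * (2 * t + 1) ≤ cross (c - a) (d - b)

theorem SectorBound.succ {t : ℝ} (ht : t ^ 2 = 1 - t) {δ n : ℕ} (h : SectorBound t δ n) :
    SectorBound t δ (n + 1) := by
  intro a b c d H x₁ y₁ x₂ y₂ hx₁ hy₁ hx₂ hy₂ h₁ h₂
  have hray : ∀ k, turn t (turn t (ray t (k + 1))) = -ray t k := fun k => by
    rw [← ray_add_two ht, ← ray_add_two ht]; rfl
  have hmap : ∀ {p q : ℝ × ℝ} {x y : ℝ} {k : ℕ},
      q - p = x • ray t (k + 1) + y • ray t (k + 1 + 1) →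
      turn t (turn t p) - turn t (turn t q) = x • ray t k + y • ray t (k + 1) := by
    intro p q x y k hpq
    rw [← map_sub, ← map_sub, ← neg_sub, hpq]
    simp only [map_neg, map_add, map_smul, hray]
    module
  have := h ((H.shift.shift.turn ht).turn ht) hx₁ hy₁ hx₂ hy₂ (hmap h₁)
    (hmap (k := n + δ) (by rw [h₂, add_right_comm n 1 δ]))
  rw [← map_sub, ← map_sub, ← map_sub, ← map_sub, cross_turn, cross_turn, ← neg_sub c,
    ← neg_sub d, cross_neg_left, cross_swap, cross_neg_left, neg_neg, cross_swap] at this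
  linarith [cross_swap (c - a) (d - b)]

theorem sectorBound {t : ℝ} (ht : t ^ 2 = 1 - t) (ht₁ : 3 / 5 ≤ t) (ht₂ : t ≤ 5 / 8) {δ : ℕ}
    (hδ : δ ≤ 2) (n : ℕ) : SectorBound t δ n := by
  induction n with
  | zero =>
    intro a b c d H x₁ y₁ x₂ y₂ hx₁ hy₁ hx₂ hy₂ h₁ h₂
    interval_cases δ
    · exact H.le_cross_of_sector_zero ht ht₁ ht₂ hx₁ hy₁ hx₂ hy₂ h₁ h₂
    · exact H.le_cross_of_sector_one ht ht₁ ht₂ hx₁ hy₁ hx₂ hy₂ h₁ h₂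
    · exact H.le_cross_of_sector_two ht ht₁ ht₂ hx₁ hy₁ hx₂ hy₂ h₁ h₂
  | succ n ih => exact ih.succ ht

theorem Encloses.three_mul_le_cross {t : ℝ} {a b c d : ℝ × ℝ} (h : Encloses t a b c d)
    (ht : t ^ 2 = 1 - t) (ht₁ : 3 / 5 ≤ t) (ht₂ : t ≤ 5 / 8) :
    3 * (2 * t + 1) ≤ cross (c - a) (d - b) := by
  obtain ⟨n, x₁, y₁, hx₁, hy₁, h₁⟩ : ∃ n, ∃ x y : ℝ, 0 ≤ x ∧ 0 ≤ y ∧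
      c - a = x • ray t n + y • ray t (n + 1) := by
    rcases le_total 0 (cross (ray t 0) (c - a)) with hs | hs
    · obtain ⟨δ, -, hδ⟩ := exists_sector ht ht₁ hs
      exact ⟨_, hδ⟩
    · have hs' : 0 ≤ cross (ray t 5) (c - a) := by
        rw [show ray t 5 = -ray t 0 from rfl, cross_neg_left]; linarith
      obtain ⟨δ, -, hδ⟩ := exists_sector ht ht₁ hs'
      exact ⟨_, hδ⟩
  have hac : a - c = x₁ • ray t (n + 5) + y₁ • ray t (n + 5 + 1) := by
    rw [← neg_sub, h₁, show n + 5 + 1 = n + 1 + 5 from rfl, ray, ray]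
    module
  have hshift : ∀ {δ : ℕ} {x₂ y₂ : ℝ}, 0 ≤ x₂ → 0 ≤ y₂ → 3 ≤ δ → δ ≤ 5 →
      d - b = x₂ • ray t (n + δ) + y₂ • ray t (n + δ + 1) →
      3 * (2 * t + 1) ≤ cross (c - a) (d - b) := fun {δ x₂ y₂} hx₂ hy₂ hδ hδ' h₂ => by
    rw [← Encloses.cross_shift]
    refine sectorBound ht ht₁ ht₂ (δ := 5 - δ) (by omega) (n + δ) h.shift hx₂ hy₂ hx₁ hy₁ h₂ ?_
    rwa [show n + δ + (5 - δ) = n + 5 by omega]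
  rcases le_total 0 (cross (ray t n) (d - b)) with hs | hs
  · obtain ⟨δ, hδ, x₂, y₂, hx₂, hy₂, h₂⟩ := exists_sector ht ht₁ hs
    rcases le_or_gt δ 2 with hle | hlt
    · exact sectorBound ht ht₁ ht₂ hle n h hx₁ hy₁ hx₂ hy₂ h₁ h₂
    · exact hshift hx₂ hy₂ hlt (by omega) h₂
  · rcases le_total 0 (cross (ray t (n + 1)) (d - b)) with hs' | hs'
    · obtain ⟨x₂, y₂, hx₂, hy₂, h₂⟩ := exists_nonneg_combination (cross_ray_pos ht ht₁ (n + 5))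
        (v := d - b) (by rw [ray, cross_neg_left]; linarith)
        (by rw [show n + 5 + 1 = n + 1 + 5 from rfl, cross_swap, ray, cross_neg_left]; linarith)
      exact hshift hx₂ hy₂ (by norm_num) le_rfl h₂
    · have hpos := h.pos
      have : cross (c - a) (d - b) =
          x₁ * cross (ray t n) (d - b) + y₁ * cross (ray t (n + 1)) (d - b) := by
        rw [h₁]
        simp only [cross, Prod.fst_add, Prod.snd_add, Prod.smul_fst, Prod.smul_snd, smul_eq_mul]
        ring
      nlinarith

theorem volume_affinePentagon {t : ℝ} (ht : t ^ 2 = 1 - t) (ht₁ : 3 / 5 ≤ t) (ht₂ : t ≤ 5 / 8) :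
    volume (affinePentagon t) = ENNReal.ofReal (5 / 2) := by
  rw [affinePentagon, volume_convexHull_pentagon]
  · congr 2
    simp only [orient]
    linear_combination 2 * ht
  all_goals simp only [orient]; nlinarith

theorem isConvexPolygon_affinePentagon {t : ℝ} (ht : t ^ 2 = 1 - t) (ht₁ : 3 / 5 ≤ t)
    (ht₂ : t ≤ 5 / 8) : IsConvexPolygon 5 (affinePentagon t) := by
  classical
  refine ⟨{(1, 0), (0, 1), (-1, t), (-t, -t), (t, -1)}, Finset.card_le_five, ?_, ?_⟩
  · simp [affinePentagon]
  · by_contra! h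
    have h₀ := (convex_convexHull ℝ _ : Convex ℝ (affinePentagon t)).addHaar_frontier volume
    have h₁ := (subset_closure (s := affinePentagon t))
    rw [closure_eq_interior_union_frontier, h, Set.empty_union] at h₁
    have h₂ := measure_mono_null h₁ h₀
    rw [volume_affinePentagon ht ht₁ ht₂, ENNReal.ofReal_eq_zero] at h₂
    norm_num at h₂

theorem le_volume_of_affinePentagon_subset {t : ℝ} (ht : t ^ 2 = 1 - t) (ht₁ : 3 / 5 ≤ t)
    (ht₂ : t ≤ 5 / 8) {Q : Set (ℝ × ℝ)} (hQ : IsConvexPolygon 4 Q) (h : affinePentagon t ⊆ Q) :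
    3 * (2 * t + 1) / 2 ≤ (volume Q).toReal := by
  obtain ⟨a, b, c, d, hsides, hvol⟩ := exists_sides_of_isConvexPolygon_four hQ
  have hcross : cross (c - a) (d - b) = orient a b c + orient a c d := by
    simp only [cross, orient, Prod.fst_sub, Prod.snd_sub]; ring
  have hpos := volume_pos_of_isConvexPolygon hQ
  have henc : Encloses t a b c d := ⟨fun q hq => hsides q (h hq), by linarith⟩
  linarith [henc.three_mul_le_cross ht ht₁ ht₂]

/-- A pentagon all of whose circumscribed quadrilaterals have relative area at least `3 / √5`. -/
theorem exists_pentagon_forall_quad : ∃ P : Set (ℝ × ℝ), IsConvexPolygon 5 P ∧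
    ∀ Q, IsConvexPolygon 4 Q → P ⊆ Q → 3 / √5 ≤ (volume Q).toReal / (volume P).toReal := by
  have h5 : √5 ^ 2 = 5 := Real.sq_sqrt (by norm_num)
  have h₁ : 11 / 5 ≤ √5 := Real.le_sqrt_of_sq_le (by norm_num)
  have h₂ : √5 ≤ 9 / 4 := Real.sqrt_le_iff.2 (by norm_num)
  obtain ⟨t, ht⟩ : ∃ t, 2 * t + 1 = √5 := ⟨(√5 - 1) / 2, by ring⟩
  have ht' : t ^ 2 = 1 - t := by rw [← ht] at h5; linarith
  have ht₁ : 3 / 5 ≤ t := by linarith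
  have ht₂ : t ≤ 5 / 8 := by linarith
  refine ⟨_, isConvexPolygon_affinePentagon ht' ht₁ ht₂, fun Q hQ hPQ => ?_⟩
  have hle := le_volume_of_affinePentagon_subset ht' ht₁ ht₂ hQ hPQ
  rw [volume_affinePentagon ht' ht₁ ht₂, ENNReal.toReal_ofReal (by norm_num),
    div_le_div_iff₀ (by positivity) (by norm_num)]
  rw [ht] at hle
  nlinarith

/-- `r(4,5) = 3/√5`: the supremum over convex pentagons `P` of the infimum over
convex quadrilaterals `Q ⊇ P` of the ratio `|Q|/|P|` equals `3/√5`. -/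
theorem r_four_five :
    sSup {r : ℝ | ∃ P : Set (ℝ × ℝ), IsConvexPolygon 5 P ∧
      r = sInf {s : ℝ | ∃ Q : Set (ℝ × ℝ), IsConvexPolygon 4 Q ∧ P ⊆ Q ∧
        s = (volume Q).toReal / (volume P).toReal}} = 3 / Real.sqrt 5 := by
  have hle : ∀ r ∈ {r : ℝ | ∃ P : Set (ℝ × ℝ), IsConvexPolygon 5 P ∧
      r = sInf {s : ℝ | ∃ Q : Set (ℝ × ℝ), IsConvexPolygon 4 Q ∧ P ⊆ Q ∧
        s = (volume Q).toReal / (volume P).toReal}}, r ≤ 3 / √5 := by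
    rintro r ⟨P, hP, rfl⟩
    obtain ⟨Q, hQ, hPQ, h⟩ := exists_quad_of_isConvexPolygon_five hP
    refine csInf_le_of_le ⟨0, ?_⟩ ⟨Q, hQ, hPQ, rfl⟩
      ((div_le_iff₀ (volume_pos_of_isConvexPolygon hP)).2 h)
    rintro s ⟨Q, -, -, rfl⟩
    positivity
  obtain ⟨P, hP, h⟩ := exists_pentagon_forall_quad
  refine le_antisymm (csSup_le ⟨_, P, hP, rfl⟩ hle) ?_
  refine le_trans ?_ (le_csSup ⟨_, hle⟩ ⟨P, hP, rfl⟩)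
  obtain ⟨Q, hQ, hPQ, -⟩ := exists_quad_of_isConvexPolygon_five hP
  refine le_csInf ⟨_, Q, hQ, hPQ, rfl⟩ ?_
  rintro s ⟨Q, hQ, hPQ, rfl⟩
  exact h Q hQ hPQ
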